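/- Let E : ℝ³∖{0} → ℝ satisfy |∂_x^α E(x)| ≤ C_α/|x|^{|α|+1} for all multi-indices α with |α| ≤ 2. If φ is a smooth scalar function of the form φ = ∇·φ₁ + φ₂ with L₁(φ) := ‖(1+|x|)³φ‖_{L^∞} + ‖(1+|x|)²φ₁‖_{L^∞} + ‖φ₂‖_{L¹} < ∞, then for |α| ≤ 1 there is a constant C_α (depending only on α and the constants for E) such that |∂_x^α(E ∗ φ)(x)| ≤ C_α |x|^{-(|α|+1)} L₁(φ) for all x ≠ 0. -/

import Mathlib

noncomputable section
open MeasureTheory Real Filter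
open scoped ENNReal RealInnerProductSpace BigOperators

abbrev E3 := EuclideanSpace ℝ (Fin 3)

def pd (i : Fin 3) (f : E3 → ℝ) (x : E3) : ℝ := fderiv ℝ f x (EuclideanSpace.single i (1:ℝ))
def lap (f : E3 → ℝ) (x : E3) : ℝ := ∑ i, pd i (pd i f) x
def divg (v : E3 → E3) (x : E3) : ℝ := ∑ i, fderiv ℝ v x (EuclideanSpace.single i (1:ℝ)) i
def lapv (v : E3 → E3) (x : E3) : E3 :=
  (WithLp.equiv 2 (Fin 3 → ℝ)).symm fun i => lap (fun y => v y i) x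

def weight (R : ℝ) (u : E3) : ℝ := 1 / (‖u‖ ^ 2 * (R + ‖u‖) ^ 2)

lemma weight_nonneg (R : ℝ) (u : E3) : 0 ≤ weight R u := by
  unfold weight; positivity

lemma integrable_weight_one : Integrable (weight 1) := by
  have h := integrable_fun_norm_addHaar (volume : Measure E3)
    (f := fun r : ℝ => 1 / (r ^ 2 * (1 + r) ^ 2))
  refine h.2 ?_
  have h1 : Integrable (fun x : ℝ => (1 + ‖x‖) ^ (-(2 : ℝ))) :=
    integrable_one_add_norm (by simp)
  refine (h1.integrableOn (s := Set.Ioi 0)).congr_fun ?_ measurableSet_Ioi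
  intro r hr
  have hr' : (0 : ℝ) < r := hr
  simp only [finrank_euclideanSpace, Fintype.card_fin, smul_eq_mul, Real.norm_of_nonneg hr'.le]
  rw [Real.rpow_neg (by positivity), Real.rpow_two]
  field_simp

lemma weight_smul {R : ℝ} (hR : 0 < R) (u : E3) :
    weight R (R • u) = R⁻¹ ^ 4 * weight 1 u := by
  unfold weight
  rw [norm_smul, Real.norm_of_nonneg hR.le]
  rcases eq_or_ne u 0 with rfl | hu
  · simp
  have : 0 < ‖u‖ := norm_pos_iff.2 hu
  field_simp

lemma integrable_weight {R : ℝ} (hR : 0 < R) : Integrable (weight R) := by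
  rw [← integrable_comp_smul_iff volume _ hR.ne']
  simp only [weight_smul hR]
  exact integrable_weight_one.const_mul _

lemma integral_weight {R : ℝ} (hR : 0 < R) :
    ∫ u, weight R u = (∫ u, weight 1 u) / R := by
  have h := Measure.integral_comp_smul (volume : Measure E3) (weight R) R
  simp only [weight_smul hR, integral_const_mul, finrank_euclideanSpace, Fintype.card_fin,
    smul_eq_mul] at h
  rw [abs_of_pos (by positivity)] at h
  field_simp at h ⊢
  linarith

lemma inv_sq_le_weight {ρ : ℝ} {u : E3} (hu : u ≠ 0) (h : ‖u‖ ≤ ρ) :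
    1 / ‖u‖ ^ 2 ≤ 4 * ρ ^ 2 * weight ρ u := by
  have hu' : 0 < ‖u‖ := norm_pos_iff.2 hu
  have hρ : 0 < ρ := hu'.trans_le h
  unfold weight
  rw [mul_one_div, div_le_div_iff₀ (by positivity) (by positivity), one_mul, mul_comm]
  gcongr
  nlinarith

/-- Smooth cutoffs at every scale with uniformly controlled gradient. -/
lemma exists_cutoff : ∃ L : ℝ, 0 ≤ L ∧ ∀ (c : E3) (s : ℝ), 0 < s → ∃ η : E3 → ℝ,
    ContDiff ℝ 1 η ∧ HasCompactSupport η ∧ (∀ y, 0 ≤ η y) ∧ (∀ y, η y ≤ 1) ∧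
    (∀ y, ‖y - c‖ ≤ s → η y = 1) ∧ (∀ y, 2 * s ≤ ‖y - c‖ → η y = 0) ∧
    (∀ y, ‖fderiv ℝ η y‖ ≤ L / s) ∧ (∀ y, 2 * s ≤ ‖y - c‖ → fderiv ℝ η y = 0) := by
  let b : ContDiffBump (0 : E3) := ⟨1, 2, by norm_num, by norm_num⟩
  have hb : ContDiff ℝ 1 b := b.contDiff
  obtain ⟨L, hL⟩ := (hb.continuous_fderiv one_ne_zero).bounded_above_of_compact_support
    (b.hasCompactSupport.fderiv ℝ)
  refine ⟨L, (norm_nonneg _).trans (hL 0), fun c s hs => ⟨fun y => b (s⁻¹ • (y - c)), ?_, ?_,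
    fun y => b.nonneg, fun y => b.le_one, ?_, ?_, ?_, ?_⟩⟩
  · exact hb.comp (by fun_prop)
  · refine HasCompactSupport.of_support_subset_isCompact (isCompact_closedBall c (2 * s)) ?_
    intro y hy
    by_contra hcon
    refine hy (b.zero_of_le_dist ?_)
    rw [Metric.mem_closedBall, dist_eq_norm, not_le] at hcon
    rw [dist_zero_right, norm_smul, norm_inv, Real.norm_of_nonneg hs.le]
    change 2 ≤ _
    rw [inv_mul_eq_div, le_div_iff₀ hs]
    exact hcon.le
  · intro y hy
    refine b.one_of_mem_closedBall ?_
    rw [mem_closedBall_zero_iff, norm_smul, norm_inv, Real.norm_of_nonneg hs.le]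
    change _ ≤ (1 : ℝ)
    rw [inv_mul_eq_div, div_le_iff₀ hs]
    linarith
  · intro y hy
    refine b.zero_of_le_dist ?_
    rw [dist_zero_right, norm_smul, norm_inv, Real.norm_of_nonneg hs.le]
    change 2 ≤ _
    rw [inv_mul_eq_div, le_div_iff₀ hs]
    exact hy
  · intro y
    have h1 : HasFDerivAt (fun y : E3 => s⁻¹ • (y - c)) (s⁻¹ • ContinuousLinearMap.id ℝ E3) y :=
      ((hasFDerivAt_id y).sub_const c).const_smul s⁻¹
    have h2 := (hb.differentiable one_ne_zero (s⁻¹ • (y - c))).hasFDerivAt.comp y h1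
    have h3 : fderiv ℝ (fun y => b (s⁻¹ • (y - c))) y = s⁻¹ • fderiv ℝ b (s⁻¹ • (y - c)) := by
      refine h2.fderiv.trans ?_
      ext v; simp
    rw [h3, norm_smul, norm_inv, Real.norm_of_nonneg hs.le, inv_mul_eq_div]
    gcongr
    exact hL _
  · intro y hy
    refine IsLocalMin.fderiv_eq_zero (Filter.Eventually.of_forall fun w => ?_)
    have : b (s⁻¹ • (y - c)) = 0 := by
      refine b.zero_of_le_dist ?_
      rw [dist_zero_right, norm_smul, norm_inv, Real.norm_of_nonneg hs.le]
      change 2 ≤ _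
      rw [inv_mul_eq_div, le_div_iff₀ hs]
      exact hy
    change b (s⁻¹ • (y - c)) ≤ b (s⁻¹ • (w - c))
    rw [this]
    exact b.nonneg

lemma integral_mul_divg {G : E3 → ℝ} {v : E3 → E3} (hG : ContDiff ℝ 1 G)
    (hGc : HasCompactSupport G) (hv : ContDiff ℝ 1 v) :
    ∫ y, G y * divg v y = -∫ y, fderiv ℝ G y (v y) := by
  have hG' := hG.continuous_fderiv one_ne_zero
  have hv' := hv.continuous_fderiv one_ne_zero
  have hvi : ∀ i : Fin 3, ContDiff ℝ 1 (fun y => v y i) := fun i => by fun_prop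
  have hvd : ∀ (i : Fin 3) (y w : E3), fderiv ℝ (fun y => v y i) y w = fderiv ℝ v y w i := by
    intro i y w
    have h := (EuclideanSpace.proj (𝕜 := ℝ) i).hasFDerivAt.comp y
      (hv.differentiable one_ne_zero y).hasFDerivAt
    exact congrArg (fun l => l w) h.fderiv
  have key : ∀ i : Fin 3,
      Integrable (fun y => G y * fderiv ℝ v y (EuclideanSpace.single i (1:ℝ)) i) ∧
      Integrable (fun y => fderiv ℝ G y (EuclideanSpace.single i (1:ℝ)) * v y i) ∧
      ∫ y, G y * fderiv ℝ v y (EuclideanSpace.single i (1:ℝ)) i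
        = -∫ y, fderiv ℝ G y (EuclideanSpace.single i (1:ℝ)) * v y i := by
    intro i
    have i1 : Integrable (fun y => G y * fderiv ℝ v y (EuclideanSpace.single i (1:ℝ)) i) := by
      refine Continuous.integrable_of_hasCompactSupport ?_ hGc.mul_right
      have := hG.continuous
      fun_prop
    have i2 : Integrable (fun y => fderiv ℝ G y (EuclideanSpace.single i (1:ℝ)) * v y i) := by
      refine Continuous.integrable_of_hasCompactSupport ?_ (hGc.fderiv_apply ℝ _).mul_right
      have := (hvi i).continuous
      fun_prop
    have i3 : Integrable (fun y => G y * v y i) :=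
      Continuous.integrable_of_hasCompactSupport (hG.continuous.mul (hvi i).continuous)
        hGc.mul_right
    refine ⟨i1, i2, ?_⟩
    have := integral_mul_fderiv_eq_neg_fderiv_mul_of_integrable (μ := (volume : Measure E3))
      (f := G) (g := fun y => v y i) (v := EuclideanSpace.single i (1:ℝ)) i2
      (by simpa only [hvd] using i1) i3 (fun x _ => hG.differentiable one_ne_zero x)
      (fun x _ => (hvi i).differentiable one_ne_zero x)
    simpa only [hvd] using this
  have hsum : ∀ y, fderiv ℝ G y (v y)
      = ∑ i, fderiv ℝ G y (EuclideanSpace.single i (1:ℝ)) * v y i := by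
    intro y
    conv_lhs => rw [← (EuclideanSpace.basisFun (Fin 3) ℝ).sum_repr (v y)]
    simp [mul_comm]
  simp only [hsum, divg, Finset.mul_sum]
  rw [integral_finsetSum _ fun i _ => (key i).1, integral_finsetSum _ fun i _ => (key i).2.1,
    ← Finset.sum_neg_distrib]
  exact Finset.sum_congr rfl fun i _ => (key i).2.2

lemma norm_sub_le_of_fderiv_decay {V : Type*} [NormedAddCommGroup V] [NormedSpace ℝ V]
    {F : E3 → V} {c : ℝ} {m : ℕ} (hc : 0 ≤ c) (hF : ∀ x, x ≠ 0 → DifferentiableAt ℝ F x)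
    (hb : ∀ x, x ≠ 0 → ‖fderiv ℝ F x‖ ≤ c / ‖x‖ ^ m) {a b : E3} (ha : a ≠ 0)
    (hab : ‖b - a‖ ≤ ‖a‖ / 2) :
    ‖F b - F a‖ ≤ c * 2 ^ m / ‖a‖ ^ m * ‖b - a‖ := by
  have ha' : 0 < ‖a‖ := norm_pos_iff.2 ha
  have hfar : ∀ u ∈ Metric.closedBall a (‖a‖ / 2), ‖a‖ / 2 ≤ ‖u‖ := by
    intro u hu
    rw [mem_closedBall_iff_norm] at hu
    have := norm_sub_norm_le a u
    rw [norm_sub_rev] at this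
    linarith
  have hne : ∀ u ∈ Metric.closedBall a (‖a‖ / 2), u ≠ 0 := fun u hu =>
    norm_pos_iff.1 ((half_pos ha').trans_le (hfar u hu))
  refine Convex.norm_image_sub_le_of_norm_fderiv_le (𝕜 := ℝ) (s := Metric.closedBall a (‖a‖ / 2))
    (fun u hu => hF u (hne u hu)) (fun u hu => (hb u (hne u hu)).trans ?_)
    (convex_closedBall _ _) (Metric.mem_closedBall_self (by positivity))
    (mem_closedBall_iff_norm.2 hab)
  have h := hfar u hu
  calc c / ‖u‖ ^ m ≤ c / (‖a‖ / 2) ^ m := by gcongr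
    _ = c * 2 ^ m / ‖a‖ ^ m := by rw [div_pow]; field_simp

/-- The substitute for the mean value theorem across a singularity of order one. -/
lemma abs_sub_le_of_decay {E : E3 → ℝ} {c : ℝ} (hc : 0 ≤ c)
    (hd : ∀ x, x ≠ 0 → DifferentiableAt ℝ E x) (h0 : ∀ x, x ≠ 0 → |E x| ≤ c / ‖x‖)
    (h1 : ∀ x, x ≠ 0 → ‖fderiv ℝ E x‖ ≤ c / ‖x‖ ^ 2) {a b : E3} (ha : a ≠ 0) (hb : b ≠ 0) :
    |E b - E a| ≤ 4 * c * ‖b - a‖ * (1 / ‖a‖ ^ 2 + 1 / ‖b‖ ^ 2) := by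
  have ha' : 0 < ‖a‖ := norm_pos_iff.2 ha
  have hb' : 0 < ‖b‖ := norm_pos_iff.2 hb
  rw [mul_add]
  have p1 : 0 ≤ 4 * c * ‖b - a‖ * (1 / ‖a‖ ^ 2) := by positivity
  have p2 : 0 ≤ 4 * c * ‖b - a‖ * (1 / ‖b‖ ^ 2) := by positivity
  by_cases h : ‖b - a‖ ≤ ‖a‖ / 2
  · have := norm_sub_le_of_fderiv_decay hc hd h1 ha h
    rw [Real.norm_eq_abs] at this
    have e : c * 2 ^ 2 / ‖a‖ ^ 2 * ‖b - a‖ = 4 * c * ‖b - a‖ * (1 / ‖a‖ ^ 2) := by ring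
    linarith
  by_cases h' : ‖a - b‖ ≤ ‖b‖ / 2
  · have := norm_sub_le_of_fderiv_decay hc hd h1 hb h'
    rw [Real.norm_eq_abs, abs_sub_comm, norm_sub_rev] at this
    have e : c * 2 ^ 2 / ‖b‖ ^ 2 * ‖b - a‖ = 4 * c * ‖b - a‖ * (1 / ‖b‖ ^ 2) := by ring
    linarith
  rw [norm_sub_rev] at h'
  push Not at h h'
  have q : ∀ t : ℝ, 0 < t → t / 2 < ‖b - a‖ → c / t ≤ 4 * c * ‖b - a‖ * (1 / t ^ 2) := by
    intro t ht hh
    rw [mul_one_div, div_le_div_iff₀ ht (by positivity)]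
    nlinarith [mul_nonneg hc ht.le, mul_nonneg (mul_nonneg hc ht.le) (sub_nonneg.2 hh.le)]
  calc |E b - E a| ≤ |E b| + |E a| := abs_sub _ _
    _ ≤ c / ‖b‖ + c / ‖a‖ := add_le_add (h0 b hb) (h0 a ha)
    _ ≤ _ := by linarith [q _ ha' h, q _ hb' h']

lemma abs_integral_mul_le_of_fderiv_decay : ∃ c : ℝ, 0 ≤ c ∧
    ∀ (φ φ₂ : E3 → ℝ) (φ₁ : E3 → E3) (M₂ M₃ : ℝ),
      Continuous φ → Continuous φ₂ → ContDiff ℝ 1 φ₁ → (∀ x, φ x = divg φ₁ x + φ₂ x) →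
      (∀ x, (1 + ‖x‖) ^ 2 * ‖φ₁ x‖ ≤ M₂) → Integrable φ₂ → (∫ x, |φ₂ x|) ≤ M₃ →
      ∀ (G : E3 → ℝ) (A B R : ℝ), 0 < R → ContDiff ℝ 1 G → (∀ y, |G y| ≤ A) →
        (∀ y, ‖fderiv ℝ G y‖ ≤ B / (R + ‖y‖) ^ 2) → Integrable (fun y => G y * φ y) →
        |∫ y, G y * φ y| ≤ A * M₃ + c * (A + B / R) * M₂ := by
  obtain ⟨L, hL0, hL⟩ := exists_cutoff
  set I : ℝ := ∫ u, weight 1 u with hI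
  have hI0 : 0 ≤ I := integral_nonneg (weight_nonneg 1)
  refine ⟨I + 9 * L * I, by positivity, ?_⟩
  intro φ φ₂ φ₁ M₂ M₃ hφ hφ₂ hφ₁ hdec hM₂ hint hM₃ G A B R hR hG hGA hGB hGφ
  have hA : 0 ≤ A := (abs_nonneg _).trans (hGA 0)
  have hB : 0 ≤ B := by
    have h := (norm_nonneg _).trans (hGB 0)
    rw [norm_zero, add_zero] at h
    by_contra hneg
    exact absurd h (not_le.2 (div_neg_of_neg_of_pos (not_le.1 hneg) (by positivity)))
  have hM₂0 : 0 ≤ M₂ := le_trans (by positivity) (hM₂ 0)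
  choose η hη1 hηc hη0 hηle hηone hηzero hηd hηd0 using
    fun n : ℕ => hL (0 : E3) ((n : ℝ) + 1) (by positivity)
  have hlim : Tendsto (fun n => ∫ y, η n y * G y * φ y) atTop (nhds (∫ y, G y * φ y)) := by
    refine tendsto_integral_of_dominated_convergence (fun y => |G y * φ y|) ?_ hGφ.abs ?_ ?_
    · intro n
      exact (((hη1 n).continuous.mul hG.continuous).mul hφ).aestronglyMeasurable
    · intro n
      refine Eventually.of_forall fun y => ?_
      rw [Real.norm_eq_abs, mul_assoc, abs_mul, abs_of_nonneg (hη0 n y)]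
      exact mul_le_of_le_one_left (abs_nonneg _) (hηle n y)
    · refine Eventually.of_forall fun y => ?_
      refine tendsto_const_nhds.congr' ?_
      obtain ⟨N, hN⟩ := exists_nat_ge ‖y‖
      filter_upwards [eventually_ge_atTop N] with n hn
      have hn' : (N : ℝ) ≤ n := by exact_mod_cast hn
      rw [hηone n y (by rw [sub_zero]; linarith), one_mul]
  refine le_of_tendsto hlim.abs (Eventually.of_forall fun n => ?_)
  set s : ℝ := (n : ℝ) + 1 with hs
  have hs0 : 0 < s := by positivity
  set H : E3 → ℝ := fun y => η n y * G y with hH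
  have hH1 : ContDiff ℝ 1 H := (hη1 n).mul hG
  have hHc : HasCompactSupport H := (hηc n).mul_right
  have hHA : ∀ y, |H y| ≤ A := fun y => by
    rw [hH]
    simp only [abs_mul, abs_of_nonneg (hη0 n y)]
    exact (mul_le_of_le_one_left (abs_nonneg _) (hηle n y)).trans (hGA y)
  have hHd : ∀ y, ‖fderiv ℝ H y‖ ≤ B / (R + ‖y‖) ^ 2 + 9 * A * L * s / (s + ‖y‖) ^ 2 := by
    intro y
    have e : fderiv ℝ H y = η n y • fderiv ℝ G y + G y • fderiv ℝ (η n) y :=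
      fderiv_fun_mul ((hη1 n).differentiable one_ne_zero y) (hG.differentiable one_ne_zero y)
    have e2 : ‖fderiv ℝ (η n) y‖ ≤ 9 * L * s / (s + ‖y‖) ^ 2 := by
      rcases le_total (2 * s) ‖y‖ with h | h
      · rw [hηd0 n y (by rwa [sub_zero]), norm_zero]
        positivity
      · refine (hηd n y).trans ?_
        rw [div_le_div_iff₀ hs0 (by positivity)]
        have : (s + ‖y‖) ^ 2 ≤ (3 * s) ^ 2 := by gcongr; linarith
        nlinarith
    calc ‖fderiv ℝ H y‖ ≤ η n y * ‖fderiv ℝ G y‖ + |G y| * ‖fderiv ℝ (η n) y‖ := by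
          rw [e]
          refine (norm_add_le _ _).trans ?_
          rw [norm_smul, norm_smul, Real.norm_of_nonneg (hη0 n y), Real.norm_eq_abs]
      _ ≤ 1 * (B / (R + ‖y‖) ^ 2) + A * (9 * L * s / (s + ‖y‖) ^ 2) := by
          gcongr
          · exact hηle n y
          · exact hGB y
          · exact hGA y
      _ = _ := by ring
  have i2 : Integrable (fun y => H y * φ₂ y) :=
    (hH1.continuous.mul hφ₂).integrable_of_hasCompactSupport hHc.mul_right
  have i0 : Integrable (fun y => H y * φ y) :=
    (hH1.continuous.mul hφ).integrable_of_hasCompactSupport hHc.mul_right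
  have i1 : Integrable (fun y => H y * divg φ₁ y) := by
    refine (i0.sub i2).congr (Eventually.of_forall fun y => ?_)
    simp only [Pi.sub_apply, hdec y]
    ring
  have hsplit : ∫ y, H y * φ y = -(∫ y, fderiv ℝ H y (φ₁ y)) + ∫ y, H y * φ₂ y := by
    rw [← integral_mul_divg hH1 hHc hφ₁, ← integral_add i1 i2]
    simp only [hdec, mul_add]
  have b2 : |∫ y, H y * φ₂ y| ≤ A * M₃ := by
    calc |∫ y, H y * φ₂ y| ≤ ∫ y, A * |φ₂ y| := by
          rw [← Real.norm_eq_abs]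
          refine norm_integral_le_of_norm_le (hint.abs.const_mul A)
            (Eventually.of_forall fun y => ?_)
          rw [Real.norm_eq_abs, abs_mul]
          gcongr
          exact hHA y
      _ ≤ A * M₃ := by
          rw [integral_const_mul]
          gcongr
  have b1 : |∫ y, fderiv ℝ H y (φ₁ y)| ≤ (I + 9 * L * I) * (A + B / R) * M₂ := by
    have iw : Integrable
        (fun y => M₂ * B * weight R y + M₂ * (9 * A * L * s) * weight s y) :=
      ((integrable_weight hR).const_mul _).add ((integrable_weight hs0).const_mul _)
    calc |∫ y, fderiv ℝ H y (φ₁ y)|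
        ≤ ∫ y, (M₂ * B * weight R y + M₂ * (9 * A * L * s) * weight s y) := by
          rw [← Real.norm_eq_abs]
          refine norm_integral_le_of_norm_le iw ?_
          filter_upwards [compl_mem_ae_iff.2 (measure_singleton (0 : E3))] with y hy
          have hy0 : 0 < ‖y‖ := norm_pos_iff.2 hy
          have hφy : ‖φ₁ y‖ ≤ M₂ / ‖y‖ ^ 2 := by
            rw [le_div_iff₀ (by positivity), mul_comm]
            refine le_trans ?_ (hM₂ y)
            gcongr
            linarith
          refine (ContinuousLinearMap.le_opNorm _ _).trans ?_
          refine (mul_le_mul (hHd y) hφy (norm_nonneg _) (by positivity)).trans (le_of_eq ?_)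
          unfold weight
          field_simp
      _ = M₂ * B * (I / R) + M₂ * (9 * A * L * s) * (I / s) := by
          rw [integral_add ((integrable_weight hR).const_mul _)
            ((integrable_weight hs0).const_mul _), integral_const_mul, integral_const_mul,
            integral_weight hR, integral_weight hs0]
      _ = (I * (B / R) + 9 * L * I * A) * M₂ := by field_simp
      _ ≤ _ := by
          gcongr
          have : 0 ≤ B / R := by positivity
          nlinarith [mul_nonneg hI0 hA, mul_nonneg (mul_nonneg hL0 hI0) this]
  change |∫ y, H y * φ y| ≤ _
  rw [hsplit]
  refine (abs_add_le _ _).trans ?_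
  rw [abs_neg]
  linarith

/-- The common estimate for `E (x - ·)` and for its increments `E (z - ·) - E (x - ·)`. -/
lemma abs_integral_mul_le_of_kernel_decay : ∃ c : ℝ, 0 ≤ c ∧
    ∀ (φ φ₂ : E3 → ℝ) (φ₁ : E3 → E3) (M₁ M₂ M₃ : ℝ),
      Continuous φ → Continuous φ₂ → ContDiff ℝ 1 φ₁ → (∀ x, φ x = divg φ₁ x + φ₂ x) →
      (∀ x, (1 + ‖x‖) ^ 3 * |φ x| ≤ M₁) →
      (∀ x, (1 + ‖x‖) ^ 2 * ‖φ₁ x‖ ≤ M₂) → Integrable φ₂ → (∫ x, |φ₂ x|) ≤ M₃ →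
      ∀ (K : E3 → ℝ) (D : ℝ) (x z : E3), x ≠ 0 → ‖z - x‖ ≤ ‖x‖ / 16 → 0 ≤ D →
        (∀ y, y ≠ x → y ≠ z → ‖y - x‖ < ‖x‖ / 2 →
          |K y| ≤ D * (1 / ‖x - y‖ ^ 2 + 1 / ‖z - y‖ ^ 2)) →
        (∀ y, ‖x‖ / 8 < ‖y - x‖ → ContDiffAt ℝ 1 K y ∧ |K y| ≤ D / ‖x‖ ^ 2 ∧
          ‖fderiv ℝ K y‖ ≤ D / (‖x‖ * ‖y - x‖ ^ 2)) →
        Integrable (fun y => K y * φ y) →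
        |∫ y, K y * φ y| ≤ c * (D / ‖x‖ ^ 2) * (M₁ + M₂ + M₃) := by
  obtain ⟨L, hL0, hL⟩ := exists_cutoff
  obtain ⟨c, hc0, hc⟩ := abs_integral_mul_le_of_fderiv_decay
  set I : ℝ := ∫ u, weight 1 u with hI
  have hI0 : 0 ≤ I := integral_nonneg (weight_nonneg 1)
  refine ⟨64 * I + 1 + c * (1 + 81 * (1 + L)), by positivity, ?_⟩
  intro φ φ₂ φ₁ M₁ M₂ M₃ hφ hφ₂ hφ₁ hdec hM₁ hM₂ hint hM₃ K D x z hx hzx hD hnear hfar hKφ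
  set R : ℝ := ‖x‖ with hRdef
  have hR : 0 < R := norm_pos_iff.2 hx
  have hM₁0 : 0 ≤ M₁ := le_trans (by positivity) (hM₁ 0)
  have hM₂0 : 0 ≤ M₂ := le_trans (by positivity) (hM₂ 0)
  have hM₃0 : 0 ≤ M₃ := le_trans (integral_nonneg fun _ => abs_nonneg _) hM₃
  obtain ⟨η, hη1, -, hη0, hηle, hηone, hηzero, hηd, hηd0⟩ := hL x (R / 4) (by positivity)
  have hhalf : 2 * (R / 4) = R / 2 := by ring
  rw [hhalf] at hηzero hηd0
  have iη : Integrable (fun y => η y * (K y * φ y)) := by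
    refine hKφ.bdd_mul (c := 1) hη1.continuous.aestronglyMeasurable
      (Eventually.of_forall fun y => ?_)
    rw [Real.norm_of_nonneg (hη0 y)]
    exact hηle y
  set G : E3 → ℝ := fun y => (1 - η y) * K y with hG
  have iG : Integrable (fun y => G y * φ y) := by
    refine (hKφ.sub iη).congr (Eventually.of_forall fun y => ?_)
    simp only [Pi.sub_apply, hG]
    ring
  have hGloc : ∀ y, ‖y - x‖ < R / 4 → G =ᶠ[nhds y] fun _ => 0 := by
    intro y hy
    have : {w : E3 | ‖w - x‖ < R / 4} ∈ nhds y :=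
      (isOpen_lt (by fun_prop) continuous_const).mem_nhds hy
    filter_upwards [this] with w hw
    simp only [hG]
    rw [hηone w (le_of_lt hw), sub_self, zero_mul]
  have hG1 : ContDiff ℝ 1 G := by
    rw [contDiff_iff_contDiffAt]
    intro y
    by_cases hy : ‖y - x‖ < R / 4
    · exact contDiffAt_const.congr_of_eventuallyEq (hGloc y hy)
    · exact (contDiffAt_const.sub hη1.contDiffAt).mul (hfar y (by linarith)).1
  have hGA : ∀ y, |G y| ≤ D / R ^ 2 := by
    intro y
    by_cases hy : ‖y - x‖ < R / 4
    · rw [(hGloc y hy).self_of_nhds, abs_zero]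
      positivity
    · simp only [hG]
      rw [abs_mul, abs_of_nonneg (sub_nonneg.2 (hηle y))]
      refine (mul_le_of_le_one_left (abs_nonneg _) ?_).trans (hfar y (by linarith)).2.1
      linarith [hη0 y]
  have hGd : ∀ y, ‖fderiv ℝ G y‖ ≤ 81 * (1 + L) * D / R / (R + ‖y‖) ^ 2 := by
    intro y
    by_cases hy : ‖y - x‖ < R / 4
    · rw [(hGloc y hy).fderiv_eq]
      simp only [fderiv_fun_const, Pi.zero_apply, norm_zero]
      positivity
    push Not at hy
    obtain ⟨hK1, hK2, hK3⟩ := hfar y (by linarith)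
    set d : ℝ := ‖y - x‖ with hd
    have hd0 : 0 < d := by linarith
    have e : fderiv ℝ G y = (1 - η y) • fderiv ℝ K y + K y • fderiv ℝ (fun y => 1 - η y) y :=
      fderiv_fun_mul ((hη1.differentiable one_ne_zero y).const_sub 1)
        (hK1.differentiableAt one_ne_zero)
    rw [fderiv_const_sub] at e
    have e2 : D / R ^ 2 * ‖fderiv ℝ η y‖ ≤ L * D / (R * d ^ 2) := by
      rcases le_total (R / 2) d with h | h
      · rw [hηd0 y h, norm_zero, mul_zero]
        positivity
      · calc D / R ^ 2 * ‖fderiv ℝ η y‖ ≤ D / R ^ 2 * (L / (R / 4)) := by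
              gcongr
              exact hηd y
          _ = L * D / (R * (R / 2) ^ 2) := by field_simp; ring
          _ ≤ L * D / (R * d ^ 2) := by gcongr
    have hy9 : R + ‖y‖ ≤ 9 * d := by
      have : ‖y‖ ≤ d + R := by
        have := norm_add_le (y - x) x
        rwa [sub_add_cancel] at this
      linarith
    calc ‖fderiv ℝ G y‖ ≤ (1 - η y) * ‖fderiv ℝ K y‖ + |K y| * ‖fderiv ℝ η y‖ := by
          rw [e]
          refine (norm_add_le _ _).trans ?_
          rw [norm_smul, norm_smul, norm_neg, Real.norm_of_nonneg (sub_nonneg.2 (hηle y)),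
            Real.norm_eq_abs]
      _ ≤ 1 * (D / (R * d ^ 2)) + D / R ^ 2 * ‖fderiv ℝ η y‖ := by
          gcongr
          linarith [hη0 y]
      _ ≤ D / (R * d ^ 2) + L * D / (R * d ^ 2) := by linarith
      _ = 81 * (1 + L) * D / R / (9 * d) ^ 2 := by field_simp; ring
      _ ≤ _ := by gcongr
  have bfar := hc φ φ₂ φ₁ M₂ M₃ hφ hφ₂ hφ₁ hdec hM₂ hint hM₃ G _ _ R hR hG1 hGA hGd iG
  have hz : Integrable (fun y => weight R (x - y) + weight R (z - y)) :=
    ((integrable_weight hR).comp_sub_left x).add ((integrable_weight hR).comp_sub_left z)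
  have bnear : |∫ y, η y * (K y * φ y)| ≤ 64 * I * (D / R ^ 2) * M₁ := by
    calc |∫ y, η y * (K y * φ y)|
        ≤ ∫ y, 32 * D * M₁ / R * (weight R (x - y) + weight R (z - y)) := by
          rw [← Real.norm_eq_abs]
          refine norm_integral_le_of_norm_le (hz.const_mul _) ?_
          filter_upwards [compl_mem_ae_iff.2 (measure_singleton x),
            compl_mem_ae_iff.2 (measure_singleton z)] with y hyx hyz
          have hw := add_nonneg (weight_nonneg R (x - y)) (weight_nonneg R (z - y))
          rcases le_or_gt (R / 2) ‖y - x‖ with h | h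
          · rw [hηzero y h, zero_mul, norm_zero]
            positivity
          have hxy : ‖x - y‖ < R / 2 := by rwa [norm_sub_rev]
          have w1 := inv_sq_le_weight (ρ := R) (sub_ne_zero.2 (Ne.symm hyx)) (by linarith)
          have w2 : 1 / ‖z - y‖ ^ 2 ≤ 4 * R ^ 2 * weight R (z - y) := by
            refine inv_sq_le_weight (sub_ne_zero.2 (Ne.symm hyz)) ?_
            have := norm_add_le (z - x) (x - y)
            rw [sub_add_sub_cancel] at this
            linarith
          have hKy : |K y| ≤ D * (4 * R ^ 2 * weight R (x - y) + 4 * R ^ 2 * weight R (z - y)) :=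
            (hnear y hyx hyz h).trans (by gcongr)
          have hyR : R / 2 ≤ ‖y‖ := by
            have := norm_sub_norm_le x y
            linarith
          have hφy : |φ y| ≤ 8 * M₁ / R ^ 3 := by
            rw [le_div_iff₀ (by positivity)]
            have : (R / 2) ^ 3 * |φ y| ≤ M₁ := by
              refine le_trans ?_ (hM₁ y)
              gcongr
              linarith
            linarith
          rw [Real.norm_eq_abs, abs_mul, abs_mul, abs_of_nonneg (hη0 y)]
          calc η y * (|K y| * |φ y|) ≤ 1 * (D * (4 * R ^ 2 * weight R (x - y)
                + 4 * R ^ 2 * weight R (z - y)) * (8 * M₁ / R ^ 3)) := by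
                gcongr
                · exact hηle y
                · exact (abs_nonneg _).trans hKy
            _ = _ := by field_simp; ring
      _ = 32 * D * M₁ / R * (I / R + I / R) := by
          rw [integral_const_mul, integral_add ((integrable_weight hR).comp_sub_left x)
            ((integrable_weight hR).comp_sub_left z), integral_sub_left_eq_self,
            integral_sub_left_eq_self, integral_weight hR]
      _ = _ := by field_simp; ring
  have hsplit : ∫ y, K y * φ y = (∫ y, η y * (K y * φ y)) + ∫ y, G y * φ y := by
    rw [← integral_add iη iG]
    refine integral_congr_ae (Eventually.of_forall fun y => ?_)
    simp only [hG]
    ring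
  rw [hsplit]
  refine (abs_add_le _ _).trans ((add_le_add bnear bfar).trans ?_)
  have e : c * (D / R ^ 2 + 81 * (1 + L) * D / R / R) = c * (1 + 81 * (1 + L)) * (D / R ^ 2) := by
    field_simp
  rw [e]
  have q : 0 ≤ D / R ^ 2 := by positivity
  have q1 : 0 ≤ c * (1 + 81 * (1 + L)) := by positivity
  generalize c * (1 + 81 * (1 + L)) = c' at q1
  generalize D / R ^ 2 = t at q
  have r1 : 0 ≤ (1 + c') * t * M₁ := by positivity
  have r2 : 0 ≤ (64 * I + 1) * t * M₂ := by positivity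
  have r3 : 0 ≤ (64 * I + c') * t * M₃ := by positivity
  linarith

lemma integrable_comp_sub_left_mul {E φ : E3 → ℝ} {c M : ℝ} (hc : 0 ≤ c)
    (hE : ContinuousOn E {(0 : E3)}ᶜ) (h0 : ∀ x, x ≠ 0 → |E x| ≤ c / ‖x‖) (hφ : Continuous φ)
    (hM : ∀ x, (1 + ‖x‖) ^ 3 * |φ x| ≤ M) (z : E3) :
    Integrable (fun y => E (z - y) * φ y) := by
  have hmeas : Measurable E := measurable_of_continuousOn_compl_singleton 0 hE
  have hM0 : 0 ≤ M := le_trans (by positivity) (hM 0)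
  refine (((integrable_weight one_pos).comp_sub_left z).const_mul
    (c * M * (1 + ‖z‖) ^ 3)).mono' ?_ ?_
  · exact ((hmeas.comp (measurable_const.sub measurable_id)).mul
      hφ.measurable).aestronglyMeasurable
  · filter_upwards [compl_mem_ae_iff.2 (measure_singleton z)] with y hy
    have hw : z - y ≠ 0 := sub_ne_zero.2 (Ne.symm hy)
    have hw0 : 0 < ‖z - y‖ := norm_pos_iff.2 hw
    have hφy : |φ y| ≤ M / (1 + ‖y‖) ^ 3 := by
      rw [le_div_iff₀ (by positivity), mul_comm]
      exact hM y
    have hle : ‖z - y‖ * (1 + ‖z - y‖) ^ 2 ≤ (1 + ‖z‖) ^ 3 * (1 + ‖y‖) ^ 3 := by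
      have h1 : 1 + ‖z - y‖ ≤ (1 + ‖z‖) * (1 + ‖y‖) := by
        have := norm_sub_le z y
        nlinarith [mul_nonneg (norm_nonneg z) (norm_nonneg y)]
      calc ‖z - y‖ * (1 + ‖z - y‖) ^ 2 ≤ (1 + ‖z - y‖) * (1 + ‖z - y‖) ^ 2 := by
            gcongr
            linarith
        _ = (1 + ‖z - y‖) ^ 3 := by ring
        _ ≤ ((1 + ‖z‖) * (1 + ‖y‖)) ^ 3 := by gcongr
        _ = _ := by ring
    rw [Real.norm_eq_abs, abs_mul]
    refine (mul_le_mul (h0 _ hw) hφy (abs_nonneg _) (by positivity)).trans ?_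
    unfold weight
    rw [div_mul_div_comm, mul_one_div, div_le_div_iff₀ (by positivity) (by positivity)]
    calc c * M * (‖z - y‖ ^ 2 * (1 + ‖z - y‖) ^ 2)
        = c * M * ‖z - y‖ * (‖z - y‖ * (1 + ‖z - y‖) ^ 2) := by ring
      _ ≤ c * M * ‖z - y‖ * ((1 + ‖z‖) ^ 3 * (1 + ‖y‖) ^ 3) := by gcongr
      _ = _ := by ring

lemma hasFDerivAt_comp_const_sub {E : E3 → ℝ} {a y : E3} (h : DifferentiableAt ℝ E (a - y)) :
    HasFDerivAt (fun w => E (a - w)) (-fderiv ℝ E (a - y)) y := by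
  refine (h.hasFDerivAt.comp y ((hasFDerivAt_id y).const_sub a)).congr_fderiv ?_
  ext v; simp

/-- Decay of `E ∗ φ` for `φ = ∇·φ₁ + φ₂` (Shibata–Tanaka, part (i)). -/
theorem stmt5 (E : E3 → ℝ) (CE : ℝ) (hE : ContDiffOn ℝ 2 E {(0:E3)}ᶜ)
    (hEb : ∀ k ≤ 2, ∀ x : E3, x ≠ 0 →
      ‖iteratedFDerivWithin ℝ k E {(0:E3)}ᶜ x‖ ≤ CE / ‖x‖^(k+1)) :
    ∃ C > 0, ∀ (φ φ₂ : E3 → ℝ) (φ₁ : E3 → E3) (M₁ M₂ M₃ : ℝ),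
      ContDiff ℝ (⊤ : ℕ∞) φ → ContDiff ℝ (⊤ : ℕ∞) φ₂ → ContDiff ℝ (⊤ : ℕ∞) φ₁ →
      (∀ x, φ x = divg φ₁ x + φ₂ x) →
      (∀ x, (1 + ‖x‖)^3 * |φ x| ≤ M₁) →
      (∀ x, (1 + ‖x‖)^2 * ‖φ₁ x‖ ≤ M₂) →
      Integrable φ₂ → (∫ x, |φ₂ x|) ≤ M₃ →
      ∀ k ≤ 1, ∀ x : E3, x ≠ 0 →
        ‖iteratedFDeriv ℝ k (fun z => ∫ y, E (z - y) * φ y) x‖ ≤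
          C / ‖x‖^(k+1) * (M₁ + M₂ + M₃) := by
  have hopen : IsOpen ({(0 : E3)}ᶜ : Set E3) := isOpen_compl_singleton
  have hEat : ∀ x : E3, x ≠ 0 → ContDiffAt ℝ 2 E x := fun x hx =>
    hE.contDiffAt (hopen.mem_nhds hx)
  have hEd : ∀ x : E3, x ≠ 0 → DifferentiableAt ℝ E x := fun x hx =>
    (hEat x hx).differentiableAt two_ne_zero
  have hDEd : ∀ x : E3, x ≠ 0 → DifferentiableAt ℝ (fderiv ℝ E) x := fun x hx =>
    ((hEat x hx).fderiv_right (m := 1) (by norm_num)).differentiableAt one_ne_zero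
  have hb : ∀ k ≤ 2, ∀ x : E3, x ≠ 0 → ‖iteratedFDeriv ℝ k E x‖ ≤ CE / ‖x‖ ^ (k + 1) := by
    intro k hk x hx
    rw [← iteratedFDerivWithin_of_isOpen k hopen hx]
    exact hEb k hk x hx
  have h0 : ∀ x : E3, x ≠ 0 → |E x| ≤ CE / ‖x‖ := fun x hx => by
    simpa using hb 0 (by norm_num) x hx
  have h1 : ∀ x : E3, x ≠ 0 → ‖fderiv ℝ E x‖ ≤ CE / ‖x‖ ^ 2 := fun x hx => by
    simpa only [norm_iteratedFDeriv_one] using hb 1 (by norm_num) x hx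
  have h2 : ∀ x : E3, x ≠ 0 → ‖fderiv ℝ (fderiv ℝ E) x‖ ≤ CE / ‖x‖ ^ 3 := fun x hx => by
    have := hb 2 le_rfl x hx
    rwa [← norm_iteratedFDeriv_fderiv, norm_iteratedFDeriv_one] at this
  have hCE : 0 ≤ CE := by
    obtain ⟨v, hv⟩ := exists_ne (0 : E3)
    have := (abs_nonneg _).trans (h0 v hv)
    by_contra hneg
    exact absurd this
      (not_le.2 (div_neg_of_neg_of_pos (not_le.1 hneg) (norm_pos_iff.2 hv)))
  obtain ⟨c, hc0, hc⟩ := abs_integral_mul_le_of_kernel_decay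
  refine ⟨256 * CE * c + 1, by positivity, ?_⟩
  intro φ φ₂ φ₁ M₁ M₂ M₃ hφ hφ₂ hφ₁ hdec hM₁ hM₂ hint hM₃ k hk x hx
  have hM₁0 : 0 ≤ M₁ := le_trans (by positivity) (hM₁ 0)
  have hM₂0 : 0 ≤ M₂ := le_trans (by positivity) (hM₂ 0)
  have hM₃0 : 0 ≤ M₃ := le_trans (integral_nonneg fun _ => abs_nonneg _) hM₃
  have hR : 0 < ‖x‖ := norm_pos_iff.2 hx
  have hker := hc φ φ₂ φ₁ M₁ M₂ M₃ hφ.continuous hφ₂.continuous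
    (hφ₁.of_le (by exact_mod_cast le_top)) hdec hM₁ hM₂ hint hM₃
  have hi := integrable_comp_sub_left_mul hCE hE.continuousOn h0 hφ.continuous hM₁
  have hcd : ∀ a y : E3, a ≠ y → ContDiffAt ℝ 1 (fun w => E (a - w)) y := fun a y hay =>
    ((hEat (a - y) (sub_ne_zero.2 hay)).of_le one_le_two).comp y
      (contDiffAt_const.sub contDiffAt_id)
  obtain rfl | rfl : k = 0 ∨ k = 1 := by omega
  · rw [norm_iteratedFDeriv_zero, Real.norm_eq_abs]
    refine (hker (fun y => E (x - y)) (8 * CE * ‖x‖) x x hx ?_ (by positivity) ?_ ?_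
      (hi x)).trans ?_
    · rw [sub_self, norm_zero]
      positivity
    · intro y hyx _ hy
      have hw : x - y ≠ 0 := sub_ne_zero.2 (Ne.symm hyx)
      have hw0 : 0 < ‖x - y‖ := norm_pos_iff.2 hw
      rw [norm_sub_rev] at hy
      refine (h0 _ hw).trans ?_
      rw [← two_mul, mul_one_div, mul_div_assoc', div_le_div_iff₀ hw0 (by positivity)]
      have : 0 ≤ CE * ‖x - y‖ * (16 * ‖x‖ - ‖x - y‖) := by
        refine mul_nonneg (by positivity) ?_
        linarith
      nlinarith
    · intro y hy
      have hd0 : 0 < ‖y - x‖ := by linarith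
      have hyx : x ≠ y := by
        rintro rfl
        simp at hd0
      have hw : x - y ≠ 0 := sub_ne_zero.2 hyx
      refine ⟨hcd x y hyx, ?_, ?_⟩
      · refine (h0 _ hw).trans ?_
        rw [norm_sub_rev]
        calc CE / ‖y - x‖ ≤ CE / (‖x‖ / 8) := by gcongr
          _ = 8 * CE * ‖x‖ / ‖x‖ ^ 2 := by field_simp
      · rw [(hasFDerivAt_comp_const_sub (hEd _ hw)).fderiv, norm_neg]
        refine (h1 _ hw).trans ?_
        rw [norm_sub_rev]
        calc CE / ‖y - x‖ ^ 2 ≤ 8 * CE / ‖y - x‖ ^ 2 := by gcongr; linarith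
          _ = _ := by field_simp
    · gcongr
      calc c * (8 * CE * ‖x‖ / ‖x‖ ^ 2) = 8 * CE * c / ‖x‖ ^ (0 + 1) := by rw [zero_add, pow_one]; field_simp
        _ ≤ _ := by
          gcongr
          nlinarith [mul_nonneg hCE hc0]
  · rw [norm_iteratedFDeriv_one]
    refine norm_fderiv_le_of_lip' ℝ (by positivity) ?_
    filter_upwards [Metric.closedBall_mem_nhds x (show 0 < ‖x‖ / 16 by positivity)] with z hz
    rw [mem_closedBall_iff_norm] at hz
    have hid : Integrable (fun y => (E (z - y) - E (x - y)) * φ y) := by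
      refine ((hi z).sub (hi x)).congr (Eventually.of_forall fun y => ?_)
      simp only [Pi.sub_apply]
      ring
    rw [← integral_sub (hi z) (hi x), Real.norm_eq_abs]
    simp only [← sub_mul]
    have hzx : ∀ y, (z - y) - (x - y) = z - x := fun y => sub_sub_sub_cancel_right _ _ _
    refine (hker (fun y => E (z - y) - E (x - y)) (256 * CE * ‖z - x‖) x z hx hz
      (by positivity) ?_ ?_ hid).trans ?_
    · intro y hyx hyz _
      have := abs_sub_le_of_decay hCE hEd h0 h1 (sub_ne_zero.2 (Ne.symm hyx))
        (sub_ne_zero.2 (Ne.symm hyz))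
      rw [hzx] at this
      refine this.trans ?_
      gcongr
      norm_num
    · intro y hy
      have hd0 : 0 < ‖y - x‖ := by linarith
      have hyx : x ≠ y := by
        rintro rfl
        simp at hd0
      have hw : x - y ≠ 0 := sub_ne_zero.2 hyx
      have hclose : ‖(z - y) - (x - y)‖ ≤ ‖x - y‖ / 2 := by
        rw [hzx, norm_sub_rev x y]
        linarith
      have hyz : z ≠ y := by
        rintro rfl
        linarith
      have hw' : z - y ≠ 0 := sub_ne_zero.2 hyz
      refine ⟨(hcd z y hyz).sub (hcd x y hyx), ?_, ?_⟩
      · have := norm_sub_le_of_fderiv_decay hCE hEd h1 hw hclose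
        rw [hzx, norm_sub_rev x y, Real.norm_eq_abs] at this
        refine this.trans ?_
        calc CE * 2 ^ 2 / ‖y - x‖ ^ 2 * ‖z - x‖
            ≤ CE * 2 ^ 2 / (‖x‖ / 8) ^ 2 * ‖z - x‖ := by gcongr
          _ = _ := by field_simp; ring
      · rw [((hasFDerivAt_comp_const_sub (hEd _ hw')).fun_sub
          (hasFDerivAt_comp_const_sub (hEd _ hw))).fderiv, neg_sub_neg, norm_sub_rev]
        have := norm_sub_le_of_fderiv_decay hCE hDEd h2 hw hclose
        rw [hzx, norm_sub_rev x y] at this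
        refine this.trans ?_
        calc CE * 2 ^ 3 / ‖y - x‖ ^ 3 * ‖z - x‖
            = CE * 2 ^ 3 / (‖y - x‖ * ‖y - x‖ ^ 2) * ‖z - x‖ := by ring
          _ ≤ CE * 2 ^ 3 / (‖x‖ / 8 * ‖y - x‖ ^ 2) * ‖z - x‖ := by gcongr
          _ = 64 * CE * ‖z - x‖ / (‖x‖ * ‖y - x‖ ^ 2) := by field_simp; ring
          _ ≤ _ := by
            gcongr
            norm_num
    · calc c * (256 * CE * ‖z - x‖ / ‖x‖ ^ 2) * (M₁ + M₂ + M₃)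
          = 256 * CE * c / ‖x‖ ^ (1 + 1) * (M₁ + M₂ + M₃) * ‖z - x‖ := by ring
        _ ≤ _ := by
          gcongr
          linarith
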